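/- Every quasi-identity morphism Υ : Λ_{>0}ⁿ → Λ_{>0}ⁿ is a bijection, whose inverse is again a quasi-identity morphism; consequently the quasi-identity morphisms form a group under composition. -/

import Mathlib

/-!
STATEMENT 5: Every quasi-identity morphism Υ : Λ_{>0}ⁿ → Λ_{>0}ⁿ is a bijection, whose
inverse is again a quasi-identity morphism; consequently the quasi-identity morphisms
form a group under composition.

Λ is the Novikov ring over a field 𝔽, modelled inside the Hahn series ring over ℝ
(support with finitely many exponents below any bound), with valuation
v = `HahnSeries.orderTop`, Λ_{>0} = {λ : v λ > 0}, Λ_{≥0} = {λ : v λ ≥ 0}.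
A quasi-identity morphism is a map whose components are given by convergent power
series (condition (i), convergence in the valuation topology being expressed by the
partial sums of the series having difference from the value of arbitrarily large
valuation), satisfying the contraction-type estimate (ii) with q^δ = `single δ 1`.
-/

noncomputable section

variable (𝔽 : Type*) [Field 𝔽]

/-- Membership in the Novikov ring: exponents tend to infinity. -/
def IsNovikov (f : HahnSeries ℝ 𝔽) : Prop :=
  ∀ c : ℝ, (f.support ∩ Set.Iic c).Finite

/-- `Λ_{>0}` as a subset of the Hahn series ring. -/
def NovikovGt : Set (HahnSeries ℝ 𝔽) :=
  {f | IsNovikov 𝔽 f ∧ 0 < f.orderTop}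

/-- `Λ_{≥0}` as a subset of the Hahn series ring. -/
def NovikovGe : Set (HahnSeries ℝ 𝔽) :=
  {f | IsNovikov 𝔽 f ∧ 0 ≤ f.orderTop}

/-- The open polydisc `𝒰 = Λ_{>0}ⁿ`. -/
def polydisc (n : ℕ) : Set (Fin n → HahnSeries ℝ 𝔽) :=
  {lam | ∀ i, lam i ∈ NovikovGt 𝔽}

/-- `q^δ`, the monomial with exponent `δ` and coefficient `1`. -/
def qpow (δ : ℝ) : HahnSeries ℝ 𝔽 := HahnSeries.single δ 1

/-- `f ∈ q^δ · Λ_{≥0}`. -/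
def MemQdeltaGe (δ : ℝ) (f : HahnSeries ℝ 𝔽) : Prop :=
  ∃ h ∈ NovikovGe 𝔽, f = qpow 𝔽 δ * h

/-- The power series with coefficients `c` converges at `lam` to the value `val`:
partial sums over larger and larger finite sets of monomials differ from `val` by
elements of arbitrarily large valuation. -/
def SeriesConvergesTo {n : ℕ} (c : (Fin n →₀ ℕ) → HahnSeries ℝ 𝔽)
    (lam : Fin n → HahnSeries ℝ 𝔽) (val : HahnSeries ℝ 𝔽) : Prop :=
  ∀ r : ℝ, ∃ s : Finset (Fin n →₀ ℕ), ∀ t : Finset (Fin n →₀ ℕ), s ⊆ t →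
    (r : WithTop ℝ) < (val - ∑ m ∈ t, c m * ∏ i, (lam i) ^ (m i)).orderTop

/-- A quasi-identity morphism `Υ : Λ_{>0}ⁿ → Λ_{>0}ⁿ`: (i) each component is given
by a power series in `λ₁,…,λₙ` convergent on `Λ_{>0}ⁿ`; (ii) there is `ε > 0` such
that whenever `λ'ᵢ − λᵢ ∈ q^δ·Λ_{≥0}` for all `i` (with `δ > 0`), then
`Υⱼ(λ') − λ'ⱼ − Υⱼ(λ) + λⱼ ∈ q^{δ+ε}·Λ_{≥0}` for all `j`. -/
def IsQuasiIdentity (n : ℕ)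
    (Υ : (Fin n → HahnSeries ℝ 𝔽) → (Fin n → HahnSeries ℝ 𝔽)) : Prop :=
  Set.MapsTo Υ (polydisc 𝔽 n) (polydisc 𝔽 n) ∧
  (∀ j : Fin n, ∃ c : (Fin n →₀ ℕ) → HahnSeries ℝ 𝔽,
    ∀ lam ∈ polydisc 𝔽 n, SeriesConvergesTo 𝔽 c lam (Υ lam j)) ∧
  (∃ ε : ℝ, 0 < ε ∧ ∀ lam lam', lam ∈ polydisc 𝔽 n → lam' ∈ polydisc 𝔽 n →
    ∀ δ : ℝ, 0 < δ → (∀ i, MemQdeltaGe 𝔽 δ (lam' i - lam i)) →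
    ∀ j, MemQdeltaGe 𝔽 (δ + ε) (Υ lam' j - lam' j - Υ lam j + lam j))

section QuasiIdentity

open MvPowerSeries Filter Topology
open scoped MvPowerSeries.WithPiTopology

/-- The ring of Hahn series of nonnegative order. -/
def HahnInt : Subring (HahnSeries ℝ 𝔽) where
  carrier := {f | 0 ≤ f.orderTop}
  mul_mem' {a b} ha hb := by
    rw [Set.mem_ofPred_eq] at *
    rw [HahnSeries.orderTop_mul]
    exact add_nonneg ha hb
  one_mem' := by simp
  add_mem' {a b} ha hb := by
    rw [Set.mem_ofPred_eq] at *
    exact (le_min ha hb).trans HahnSeries.min_orderTop_le_orderTop_add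
  zero_mem' := by simp
  neg_mem' {a} ha := by simpa using ha

variable {𝔽} in
lemma mem_hahnInt {f : HahnSeries ℝ 𝔽} : f ∈ HahnInt 𝔽 ↔ 0 ≤ f.orderTop :=
  Set.mem_ofPred

instance : CommRing (HahnInt 𝔽) := inferInstance

instance : CommSemiring (HahnInt 𝔽) := inferInstance

variable {𝔽} in
lemma orderTop_nonneg (f : HahnInt 𝔽) : 0 ≤ (f : HahnSeries ℝ 𝔽).orderTop :=
  mem_hahnInt.1 f.2

/-- `q^r` as an element of `HahnInt`, for `r ≥ 0`. -/
def qInt (r : ℝ) (hr : 0 ≤ r) : HahnInt 𝔽 :=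
  ⟨qpow 𝔽 r, by
    rw [mem_hahnInt, qpow, HahnSeries.orderTop_single one_ne_zero]
    exact_mod_cast hr⟩

instance : WithIdeal (HahnInt 𝔽) := ⟨Ideal.span {qInt 𝔽 1 zero_le_one}⟩

variable {𝔽}

lemma qpow_mul_qpow (r s : ℝ) : qpow 𝔽 r * qpow 𝔽 s = qpow 𝔽 (r + s) := by
  simp [qpow, HahnSeries.single_mul_single]

lemma qpow_zero : qpow 𝔽 0 = 1 := rfl

lemma qpow_pow (r : ℝ) (k : ℕ) : qpow 𝔽 r ^ k = qpow 𝔽 (k * r) := by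
  simp [qpow, HahnSeries.single_pow]

lemma orderTop_qpow (r : ℝ) : (qpow 𝔽 r).orderTop = r :=
  HahnSeries.orderTop_single one_ne_zero

/-- An element of order at least `r` is divisible by `q^r` with quotient of nonnegative order. -/
lemma exists_eq_qpow_mul {r : ℝ} {f : HahnSeries ℝ 𝔽} (hf : r ≤ f.orderTop) :
    ∃ h : HahnInt 𝔽, f = qpow 𝔽 r * h := by
  refine ⟨⟨qpow 𝔽 (-r) * f, ?_⟩, ?_⟩
  · rw [mem_hahnInt, HahnSeries.orderTop_mul, orderTop_qpow]
    calc (0 : WithTop ℝ) = ((-r : ℝ) : WithTop ℝ) + (r : ℝ) := by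
          rw [← WithTop.coe_add]; simp
      _ ≤ _ := by gcongr
  · change f = qpow 𝔽 r * (qpow 𝔽 (-r) * f)
    rw [← mul_assoc, qpow_mul_qpow, add_neg_cancel, qpow_zero, one_mul]

lemma le_orderTop_qpow_mul (r : ℝ) (h : HahnInt 𝔽) :
    r ≤ (qpow 𝔽 r * (h : HahnSeries ℝ 𝔽)).orderTop := by
  rw [HahnSeries.orderTop_mul, orderTop_qpow]
  exact le_add_of_nonneg_right (orderTop_nonneg h)

variable (𝔽) in
/-- The ideal of elements of order at least `r`. -/
def orderIdeal (r : ℝ) : Ideal (HahnInt 𝔽) where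
  carrier := {f | r ≤ (f : HahnSeries ℝ 𝔽).orderTop}
  add_mem' {a b} ha hb := by
    rw [Set.mem_ofPred_eq] at *
    exact (le_min ha hb).trans HahnSeries.min_orderTop_le_orderTop_add
  zero_mem' := by simp
  smul_mem' c x hx := by
    rw [Set.mem_ofPred_eq] at *
    rw [smul_eq_mul, Subring.coe_mul, HahnSeries.orderTop_mul]
    exact le_add_of_nonneg_of_le (orderTop_nonneg c) hx

lemma mem_orderIdeal {r : ℝ} {f : HahnInt 𝔽} :
    f ∈ orderIdeal 𝔽 r ↔ r ≤ (f : HahnSeries ℝ 𝔽).orderTop := Set.mem_ofPred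

lemma orderIdeal_anti {r s : ℝ} (h : r ≤ s) : orderIdeal 𝔽 s ≤ orderIdeal 𝔽 r :=
  fun _ hf => mem_orderIdeal.2 ((WithTop.coe_le_coe.2 h).trans (mem_orderIdeal.1 hf))

lemma withIdeal_pow (k : ℕ) : (WithIdeal.i : Ideal (HahnInt 𝔽)) ^ k = orderIdeal 𝔽 k := by
  change Ideal.span {qInt 𝔽 1 zero_le_one} ^ k = _
  ext f
  rw [Ideal.span_singleton_pow, Ideal.mem_span_singleton, mem_orderIdeal]
  have hq : ((qInt 𝔽 1 zero_le_one ^ k : HahnInt 𝔽) : HahnSeries ℝ 𝔽) = qpow 𝔽 k := by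
    rw [Subring.coe_pow]
    change qpow 𝔽 1 ^ k = _
    rw [qpow_pow, mul_one]
  constructor
  · rintro ⟨h, rfl⟩
    rw [Subring.coe_mul, hq]
    exact le_orderTop_qpow_mul _ _
  · intro h
    obtain ⟨g, hg⟩ := exists_eq_qpow_mul h
    exact ⟨g, Subtype.ext (by rw [Subring.coe_mul, hq, hg])⟩

lemma hasBasis_nhds_orderIdeal (x : HahnInt 𝔽) :
    (𝓝 x).HasBasis (fun _ : ℝ => True) fun r => {y | y - x ∈ orderIdeal 𝔽 r} := by
  have hI : (𝓝 (0 : HahnInt 𝔽)).HasBasis (fun _ : ℕ => True) fun n =>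
      ((WithIdeal.i ^ n : Ideal (HahnInt 𝔽)) : Set _) := WithIdeal.i.hasBasis_nhds_zero_adic
  have h0 : (𝓝 (0 : HahnInt 𝔽)).HasBasis (fun _ : ℝ => True) fun r =>
      (orderIdeal 𝔽 r : Set (HahnInt 𝔽)) := by
    refine hI.to_hasBasis
      (fun k _ => ⟨k, trivial, by rw [withIdeal_pow]⟩) fun r _ => ?_
    obtain ⟨k, hk⟩ := exists_nat_ge r
    exact ⟨k, trivial, by rw [withIdeal_pow]; exact orderIdeal_anti hk⟩
  have h := h0.comap fun y => y - x
  have e : comap (fun y => y - x) (𝓝 (0 : HahnInt 𝔽)) = 𝓝 x := by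
    simpa using ((Homeomorph.subRight x).isInducing.nhds_eq_comap x).symm
  rw [e] at h
  exact h

lemma isOpen_orderIdeal (r : ℝ) : IsOpen (orderIdeal 𝔽 r : Set (HahnInt 𝔽)) := by
  refine (orderIdeal 𝔽 r).toAddSubgroup.isOpen_of_mem_nhds (g := 0) ?_
  have := (hasBasis_nhds_orderIdeal (0 : HahnInt 𝔽)).mem_of_mem (i := r) trivial
  simpa using this

lemma isClosed_orderIdeal (r : ℝ) : IsClosed (orderIdeal 𝔽 r : Set (HahnInt 𝔽)) :=
  (orderIdeal 𝔽 r).toAddSubgroup.isClosed_of_isOpen (isOpen_orderIdeal r)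

lemma eq_of_forall_le_orderTop_sub {f g : HahnSeries ℝ 𝔽}
    (h : ∀ k : ℕ, ((k : ℝ) : WithTop ℝ) ≤ (f - g).orderTop) : f = g := by
  rw [← sub_eq_zero]
  ext x
  obtain ⟨k, hk⟩ := exists_nat_gt x
  exact HahnSeries.coeff_eq_zero_of_lt_orderTop ((WithTop.coe_lt_coe.2 hk).trans_le (h k))

/-- The Hahn series are complete for the topology of the order. -/
lemma exists_orderTop_sub_ge (f : ℕ → HahnSeries ℝ 𝔽)
    (hf : ∀ {m n : ℕ}, m ≤ n → ((m : ℝ) : WithTop ℝ) ≤ (f m - f n).orderTop) :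
    ∃ L : HahnSeries ℝ 𝔽, ∀ n : ℕ, ((n : ℝ) : WithTop ℝ) ≤ (f n - L).orderTop := by
  have hc {m n : ℕ} (hmn : m ≤ n) {x : ℝ} (hx : x < m) : (f n).coeff x = (f m).coeff x := by
    have := HahnSeries.coeff_eq_zero_of_lt_orderTop
      ((WithTop.coe_lt_coe.2 hx).trans_le (hf hmn))
    rw [HahnSeries.coeff_sub, sub_eq_zero] at this
    exact this.symm
  have hfl (x : ℝ) : x < (⌊x⌋₊ + 1 : ℕ) := by exact_mod_cast Nat.lt_floor_add_one x
  let c : ℝ → 𝔽 := fun x => (f (⌊x⌋₊ + 1)).coeff x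
  have hcx (n : ℕ) (x : ℝ) (hx : x < n) : c x = (f n).coeff x := by
    rcases le_total n (⌊x⌋₊ + 1) with h | h
    · exact hc h hx
    · exact (hc h (hfl x)).symm
  have hwf : (Function.support c).IsPWO := by
    rw [Set.isPWO_iff_isWF, Set.isWF_iff_no_descending_seq]
    intro u hu hmem
    obtain ⟨n, hn⟩ := exists_nat_gt (u 0)
    refine Set.isWF_iff_no_descending_seq.1 (f n).isWF_support u hu fun k => ?_
    have : u k < n := (hu.antitone (Nat.zero_le k)).trans_lt hn
    have hk := hmem k
    rw [Function.mem_support, hcx n _ this] at hk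
    exact hk
  refine ⟨⟨c, hwf⟩, fun n => HahnSeries.le_orderTop_iff_forall.2 fun x hx => ?_⟩
  rw [HahnSeries.coeff_sub]
  change _ - c x = 0
  rw [hcx n x (WithTop.coe_lt_coe.1 hx), sub_self]

lemma withIdeal_pow_smul_top (k : ℕ) :
    ((WithIdeal.i : Ideal (HahnInt 𝔽)) ^ k • ⊤ : Ideal (HahnInt 𝔽)) = orderIdeal 𝔽 k :=
  (Ideal.mul_top _).trans (withIdeal_pow k)

instance : IsAdicComplete (WithIdeal.i : Ideal (HahnInt 𝔽)) (HahnInt 𝔽) where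
  haus' x hx := by
    refine Subtype.ext (eq_of_forall_le_orderTop_sub fun k => ?_)
    have := hx k
    rw [withIdeal_pow_smul_top, SModEq.sub_mem, mem_orderIdeal] at this
    exact this
  prec' f hf := by
    simp only [withIdeal_pow_smul_top, SModEq.sub_mem, mem_orderIdeal] at hf ⊢
    obtain ⟨L, hL⟩ := exists_orderTop_sub_ge (fun k => (f k : HahnSeries ℝ 𝔽)) hf
    have hL0 : L ∈ HahnInt 𝔽 := by
      have h0 := hL 0
      have : L = f 0 - (f 0 - L) := by abel
      rw [this]
      exact sub_mem (f 0).2 (mem_hahnInt.2 (by simpa using h0))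
    exact ⟨⟨L, hL0⟩, hL⟩

lemma isAdic_withIdeal : IsAdic (WithIdeal.i : Ideal (HahnInt 𝔽)) := rfl

instance : CompleteSpace (HahnInt 𝔽) :=
  ((IsAdic.isAdicComplete_iff (isAdic_withIdeal (𝔽 := 𝔽))).1 inferInstance).1

instance : T2Space (HahnInt 𝔽) :=
  ((IsAdic.isAdicComplete_iff (isAdic_withIdeal (𝔽 := 𝔽))).1 inferInstance).2

lemma isTopologicallyNilpotent_of_orderTop_pos {f : HahnInt 𝔽}
    (hf : 0 < (f : HahnSeries ℝ 𝔽).orderTop) : IsTopologicallyNilpotent f := by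
  obtain ⟨r, hr, hrf⟩ : ∃ r : ℝ, 0 < r ∧ r ≤ (f : HahnSeries ℝ 𝔽).orderTop := by
    cases h : (f : HahnSeries ℝ 𝔽).orderTop with
    | top => exact ⟨1, one_pos, le_top⟩
    | coe r => exact ⟨r, by rw [h] at hf; exact_mod_cast hf, le_rfl⟩
  refine (hasBasis_nhds_orderIdeal 0).tendsto_right_iff.2 fun s _ => ?_
  obtain ⟨k, hk⟩ := exists_nat_ge (s / r)
  filter_upwards [eventually_ge_atTop k] with m hm
  obtain ⟨g, hg⟩ := exists_eq_qpow_mul hrf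
  rw [sub_zero, mem_orderIdeal, Subring.coe_pow, hg, mul_pow, qpow_pow,
    ← Subring.coe_pow]
  refine le_trans (WithTop.coe_le_coe.2 ?_) (le_orderTop_qpow_mul _ _)
  rw [div_le_iff₀ hr] at hk
  have : (k : ℝ) ≤ m := by exact_mod_cast hm
  nlinarith

lemma lt_orderTop_sub {r : WithTop ℝ} {f g : HahnSeries ℝ 𝔽} (hf : r < f.orderTop)
    (hg : r < g.orderTop) : r < (f - g).orderTop :=
  (lt_min hf hg).trans_le HahnSeries.min_orderTop_le_orderTop_sub

lemma le_orderTop_add {r : WithTop ℝ} {f g : HahnSeries ℝ 𝔽} (hf : r ≤ f.orderTop)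
    (hg : r ≤ g.orderTop) : r ≤ (f + g).orderTop :=
  (le_min hf hg).trans HahnSeries.min_orderTop_le_orderTop_add

lemma le_orderTop_sub {r : WithTop ℝ} {f g : HahnSeries ℝ 𝔽} (hf : r ≤ f.orderTop)
    (hg : r ≤ g.orderTop) : r ≤ (f - g).orderTop :=
  (le_min hf hg).trans HahnSeries.min_orderTop_le_orderTop_sub

/-- If the nonzero terms of a convergent series have pairwise distinct orders, then no term has
order smaller than that of the sum. -/
lemma orderTop_le_of_injective_orderTop {ι : Type*} {a : ι → HahnSeries ℝ 𝔽}
    {val : HahnSeries ℝ 𝔽}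
    (hconv : ∀ r : ℝ, ∃ s : Finset ι, ∀ t : Finset ι, s ⊆ t →
      (r : WithTop ℝ) < (val - ∑ m ∈ t, a m).orderTop)
    (hinj : ∀ m m', m ≠ m' → a m ≠ 0 → (a m).orderTop ≠ (a m').orderTop) (m : ι) :
    val.orderTop ≤ (a m).orderTop := by
  classical
  by_contra! hlt
  obtain ⟨r, hr⟩ := WithTop.ne_top_iff_exists.1 hlt.ne_top
  obtain ⟨s, hs⟩ := hconv r
  obtain ⟨m₀, hm₀, hmin⟩ := Finset.exists_min_image (insert m s) (fun x => (a x).orderTop)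
    ⟨m, Finset.mem_insert_self m s⟩
  have hle : (a m₀).orderTop ≤ r := hr ▸ hmin m (Finset.mem_insert_self m s)
  obtain ⟨r₀, hr₀⟩ := WithTop.ne_top_iff_exists.1 (hle.trans_lt (WithTop.coe_lt_top r)).ne
  have hne : a m₀ ≠ 0 := HahnSeries.orderTop_ne_top.1 (hr₀ ▸ WithTop.coe_ne_top)
  have h₁ : (val - ∑ x ∈ insert m s, a x).coeff r₀ = 0 :=
    HahnSeries.coeff_eq_zero_of_lt_orderTop
      ((hr₀ ▸ hle).trans_lt (hs _ (Finset.subset_insert m s)))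
  have h₂ : val.coeff r₀ = 0 :=
    HahnSeries.coeff_eq_zero_of_lt_orderTop ((hr₀ ▸ hle).trans_lt (hr ▸ hlt))
  rw [HahnSeries.coeff_sub, h₂, HahnSeries.coeff_sum, Finset.sum_eq_single m₀, zero_sub,
    neg_eq_zero] at h₁
  · exact HahnSeries.coeff_orderTop_ne hr₀.symm h₁
  · intro x hx hxm
    refine HahnSeries.coeff_eq_zero_of_lt_orderTop ?_
    rw [hr₀]
    exact lt_of_le_of_ne (hmin x hx) (hinj m₀ x hxm.symm hne)
  · exact fun h => absurd hm₀ h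

/-- Countably many affine hyperplanes with nonzero integral normal vector do not cover the box
`[δ, 2δ]ⁿ`. -/
lemma exists_generic_point {n : ℕ} (w : (Fin n →₀ ℕ) → ℝ) {δ : ℝ} (hδ : 0 < δ) :
    ∃ r : Fin n → ℝ, (∀ i, δ ≤ r i ∧ r i ≤ 2 * δ) ∧
      ∀ m m', m ≠ m' → w m + ∑ i, m i * r i ≠ w m' + ∑ i, m' i * r i := by
  let p : (Fin n →₀ ℕ) × (Fin n →₀ ℕ) → Polynomial ℝ := fun x =>
    Polynomial.C (w x.1 - w x.2 + ∑ i, ((x.1 i : ℝ) - x.2 i) * δ) +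
      ∑ i : Fin n, Polynomial.C ((x.1 i : ℝ) - x.2 i) * Polynomial.X ^ (i.1 + 1)
  have hp (x) (hx : x.1 ≠ x.2) : p x ≠ 0 := by
    intro h
    refine hx (Finsupp.ext fun i => ?_)
    have hi := congrArg (fun f => Polynomial.coeff f (i.1 + 1)) h
    simp only [p, Polynomial.coeff_add, Polynomial.coeff_C_succ, Polynomial.finsetSum_coeff,
      Polynomial.coeff_C_mul, Polynomial.coeff_X_pow, Polynomial.coeff_zero, zero_add,
      add_left_inj, Fin.val_inj, mul_ite, mul_one, mul_zero, Finset.sum_ite_eq,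
      Finset.mem_univ, if_true] at hi
    exact_mod_cast sub_eq_zero.1 hi
  let bad : Set ℝ := ⋃ x : {x : (Fin n →₀ ℕ) × (Fin n →₀ ℕ) // x.1 ≠ x.2}, {t | (p x).IsRoot t}
  have hbad : bad.Countable := Set.countable_iUnion fun x =>
    (Polynomial.finite_setOfPred_isRoot (hp x.1 x.2)).countable
  obtain ⟨t, ht, ht0, ht1⟩ := (hbad.dense_compl ℝ).exists_between (lt_min hδ one_pos)
  obtain ⟨htδ, ht1⟩ := lt_min_iff.1 ht1
  refine ⟨fun i => δ + t ^ (i.1 + 1), fun i => ⟨?_, ?_⟩, fun m m' hm h => ht ?_⟩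
  · have := pow_pos ht0 (i.1 + 1); linarith
  · have : t ^ (i.1 + 1) ≤ t := pow_le_of_le_one ht0.le ht1.le (by omega)
    linarith
  · refine Set.mem_iUnion.2 ⟨⟨(m, m'), hm⟩, ?_⟩
    simp only [p, Set.mem_ofPred_eq, Polynomial.IsRoot, Polynomial.eval_add, Polynomial.eval_C,
      Polynomial.eval_finsetSum, Polynomial.eval_mul, Polynomial.eval_pow, Polynomial.eval_X]
    simp only [mul_add, Finset.sum_add_distrib, sub_mul, Finset.sum_sub_distrib] at h ⊢
    linarith

lemma isNovikov_single (r : ℝ) (a : 𝔽) : IsNovikov 𝔽 (HahnSeries.single r a) := fun _ =>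
  (Set.finite_singleton r).subset (Set.inter_subset_left.trans HahnSeries.support_single_subset)

lemma mem_polydisc {n : ℕ} {lam : Fin n → HahnSeries ℝ 𝔽} :
    lam ∈ polydisc 𝔽 n ↔ ∀ i, IsNovikov 𝔽 (lam i) ∧ 0 < (lam i).orderTop := by
  simp [polydisc, NovikovGt]

lemma prod_qpow_pow {n : ℕ} (r : Fin n → ℝ) (m : Fin n →₀ ℕ) :
    ∏ i, qpow 𝔽 (r i) ^ m i = qpow 𝔽 (∑ i, m i * r i) := by
  simp_rw [qpow_pow]
  induction (Finset.univ : Finset (Fin n)) using Finset.cons_induction with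
  | empty => simp [qpow_zero]
  | cons i s hi ih => rw [Finset.prod_cons, Finset.sum_cons, ih, qpow_mul_qpow]

/-- A power series whose values on `Λ_{>0}ⁿ` have order at least `ε` has coefficients of order at
least `ε`. -/
lemma le_orderTop_coeff {n : ℕ} {c : (Fin n →₀ ℕ) → HahnSeries ℝ 𝔽}
    {val : (Fin n → HahnSeries ℝ 𝔽) → HahnSeries ℝ 𝔽} {ε : ℝ}
    (hconv : ∀ lam ∈ polydisc 𝔽 n, SeriesConvergesTo 𝔽 c lam (val lam))
    (hval : ∀ lam ∈ polydisc 𝔽 n, ε ≤ (val lam).orderTop) (m : Fin n →₀ ℕ) :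
    ε ≤ (c m).orderTop := by
  by_cases hm : c m = 0
  · simp [hm]
  rw [← HahnSeries.order_eq_orderTop_of_ne_zero hm, WithTop.coe_le_coe]
  have key (δ : ℝ) (hδ : 0 < δ) : ε ≤ (c m).order + ∑ i, m i * (2 * δ) := by
    obtain ⟨r, hr, hgen⟩ := exists_generic_point (fun m => (c m).order) hδ
    have hmem : (fun i => qpow 𝔽 (r i)) ∈ polydisc 𝔽 n := mem_polydisc.2 fun i =>
      ⟨isNovikov_single _ _, by
        rw [orderTop_qpow]; exact_mod_cast hδ.trans_le (hr i).1⟩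
    have hord (m) (h : c m ≠ 0) : (c m * ∏ i, qpow 𝔽 (r i) ^ m i).orderTop =
        ((c m).order + ∑ i, m i * r i : ℝ) := by
      rw [prod_qpow_pow, HahnSeries.orderTop_mul, orderTop_qpow,
        ← HahnSeries.order_eq_orderTop_of_ne_zero h, WithTop.coe_add]
    have h := (hval _ hmem).trans (orderTop_le_of_injective_orderTop (hconv _ hmem) ?_ m)
    · rw [hord m hm, WithTop.coe_le_coe] at h
      refine h.trans ?_
      gcongr with i
      exact (hr i).2
    · intro m m' hmm h
      have h1 : c m ≠ 0 := left_ne_zero_of_mul h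
      rw [hord m h1]
      by_cases h2 : c m' = 0
      · rw [h2, zero_mul, HahnSeries.orderTop_zero]
        exact WithTop.coe_ne_top
      · rw [hord m' h2, Ne, WithTop.coe_inj]
        exact hgen m m' hmm
  refine le_of_forall_pos_le_add fun η hη => ?_
  have hS : (0 : ℝ) ≤ ∑ i, (m i : ℝ) := by positivity
  refine (key (η / (2 * (∑ i, (m i : ℝ) + 1))) (by positivity)).trans ?_
  rw [← Finset.sum_mul, add_le_add_iff_left]
  field_simp
  nlinarith

lemma SeriesConvergesTo.sub {n : ℕ} {c c' : (Fin n →₀ ℕ) → HahnSeries ℝ 𝔽}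
    {lam : Fin n → HahnSeries ℝ 𝔽} {v v' : HahnSeries ℝ 𝔽}
    (h : SeriesConvergesTo 𝔽 c lam v) (h' : SeriesConvergesTo 𝔽 c' lam v') :
    SeriesConvergesTo 𝔽 (c - c') lam (v - v') := by
  classical
  intro r
  obtain ⟨s, hs⟩ := h r
  obtain ⟨s', hs'⟩ := h' r
  refine ⟨s ∪ s', fun t ht => ?_⟩
  have := lt_orderTop_sub (hs t (Finset.union_subset_left ht))
    (hs' t (Finset.union_subset_right ht))
  simp only [Pi.sub_apply, sub_mul, Finset.sum_sub_distrib]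
  rwa [sub_sub_sub_comm] at this

lemma SeriesConvergesTo.unique {n : ℕ} {c : (Fin n →₀ ℕ) → HahnSeries ℝ 𝔽}
    {lam : Fin n → HahnSeries ℝ 𝔽} {v v' : HahnSeries ℝ 𝔽}
    (h : SeriesConvergesTo 𝔽 c lam v) (h' : SeriesConvergesTo 𝔽 c lam v') : v = v' := by
  refine eq_of_forall_le_orderTop_sub fun k => ?_
  obtain ⟨s, hs⟩ := h.sub h' k
  simpa using (hs s subset_rfl).le

lemma seriesConvergesTo_single {n : ℕ} (m : Fin n →₀ ℕ) (a : HahnSeries ℝ 𝔽)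
    (lam : Fin n → HahnSeries ℝ 𝔽) :
    SeriesConvergesTo 𝔽 (Pi.single m a) lam (a * ∏ i, lam i ^ m i) := by
  classical
  refine fun r => ⟨{m}, fun t ht => ?_⟩
  rw [Finset.sum_eq_single m (fun x _ hx => by simp [Pi.single_eq_of_ne hx])
    (fun h => absurd (ht (Finset.mem_singleton_self m)) h)]
  simp

lemma IsNovikov.sub {f g : HahnSeries ℝ 𝔽} (hf : IsNovikov 𝔽 f) (hg : IsNovikov 𝔽 g) :
    IsNovikov 𝔽 (f - g) := fun c => by
  refine ((hf c).union (hg c)).subset fun x hx => ?_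
  by_contra h
  simp only [Set.mem_union, Set.mem_inter_iff, hx.2, and_true, HahnSeries.mem_support,
    not_or, not_not] at h
  exact hx.1 (by rw [HahnSeries.coeff_sub, h.1, h.2, sub_zero])

lemma isNovikov_zero : IsNovikov 𝔽 (0 : HahnSeries ℝ 𝔽) := fun c => by simp

lemma IsNovikov.neg {f : HahnSeries ℝ 𝔽} (hf : IsNovikov 𝔽 f) : IsNovikov 𝔽 (-f) :=
  zero_sub f ▸ isNovikov_zero.sub hf

lemma IsNovikov.add {f g : HahnSeries ℝ 𝔽} (hf : IsNovikov 𝔽 f) (hg : IsNovikov 𝔽 g) :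
    IsNovikov 𝔽 (f + g) := by
  simpa using hf.sub hg.neg

/-- The Novikov ring is closed in the Hahn series. -/
lemma IsNovikov.of_forall_approx {f : HahnSeries ℝ 𝔽}
    (h : ∀ c : ℝ, ∃ g, IsNovikov 𝔽 g ∧ (c : WithTop ℝ) < (f - g).orderTop) : IsNovikov 𝔽 f := by
  intro c
  obtain ⟨g, hg, hfg⟩ := h c
  refine (hg c).subset fun x hx => ⟨?_, hx.2⟩
  have : (f - g).coeff x = 0 :=
    HahnSeries.coeff_eq_zero_of_lt_orderTop ((WithTop.coe_le_coe.2 hx.2).trans_lt hfg)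
  rw [HahnSeries.coeff_sub, sub_eq_zero] at this
  rw [HahnSeries.mem_support, ← this]
  exact hx.1

lemma IsNovikov.qpow_mul {f : HahnSeries ℝ 𝔽} (hf : IsNovikov 𝔽 f) (r : ℝ) :
    IsNovikov 𝔽 (qpow 𝔽 r * f) := by
  intro c
  refine ((hf (c - r)).image (· + r)).subset fun x hx => ⟨x - r, ⟨?_, ?_⟩, by simp⟩
  · have h := hx.1
    rw [HahnSeries.mem_support, ← sub_add_cancel x r, qpow, HahnSeries.coeff_single_mul_add,
      one_mul] at h
    exact h
  · exact sub_le_sub_right hx.2 r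

lemma memQdeltaGe_iff {δ : ℝ} {f : HahnSeries ℝ 𝔽} :
    MemQdeltaGe 𝔽 δ f ↔ IsNovikov 𝔽 f ∧ δ ≤ f.orderTop := by
  constructor
  · rintro ⟨h, hh, rfl⟩
    rw [NovikovGe, Set.mem_ofPred_eq] at hh
    exact ⟨hh.1.qpow_mul δ, le_orderTop_qpow_mul δ ⟨h, mem_hahnInt.2 hh.2⟩⟩
  · rintro ⟨hf, hδ⟩
    obtain ⟨h, hh⟩ := exists_eq_qpow_mul hδ
    refine ⟨h, ?_, hh⟩
    rw [NovikovGe, Set.mem_ofPred_eq]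
    refine ⟨?_, orderTop_nonneg h⟩
    have : (h : HahnSeries ℝ 𝔽) = qpow 𝔽 (-δ) * f := by
      rw [hh, ← mul_assoc, qpow_mul_qpow, neg_add_cancel, qpow_zero, one_mul]
    exact this ▸ hf.qpow_mul _

lemma exists_pos_le_orderTop {n : ℕ} {f : Fin n → HahnSeries ℝ 𝔽}
    (hf : ∀ i, 0 < (f i).orderTop) : ∃ δ : ℝ, 0 < δ ∧ ∀ i, δ ≤ (f i).orderTop := by
  have h (i) : ∀ᶠ δ : ℝ in 𝓝[>] 0, δ ≤ (f i).orderTop := by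
    cases h : (f i).orderTop with
    | top => simp
    | coe r =>
      have hr : 0 < r := by have := hf i; rw [h] at this; exact_mod_cast this
      filter_upwards [nhdsWithin_le_nhds (eventually_le_nhds hr)] with δ hδ
      exact_mod_cast hδ
  obtain ⟨δ, hδ, hpos⟩ := ((eventually_all.2 h).and self_mem_nhdsWithin).exists
  exact ⟨δ, hpos, hδ⟩

section Evaluation

variable {n : ℕ}

lemma hasEval_of_finite {S : Type*} [CommRing S] [TopologicalSpace S] {a : Fin n → S}
    (ha : ∀ i, IsTopologicallyNilpotent (a i)) : HasEval a :=
  ⟨ha, by rw [Filter.cofinite_eq_bot]; exact tendsto_bot⟩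

/-- A point of the polydisc as a tuple of elements of `HahnInt`. -/
def toInt (lam : Fin n → HahnSeries ℝ 𝔽) (h : lam ∈ polydisc 𝔽 n) (i : Fin n) : HahnInt 𝔽 :=
  ⟨lam i, mem_hahnInt.2 (mem_polydisc.1 h i).2.le⟩

lemma hasEval_toInt {lam : Fin n → HahnSeries ℝ 𝔽} (h : lam ∈ polydisc 𝔽 n) :
    HasEval (toInt lam h) :=
  hasEval_of_finite fun i => isTopologicallyNilpotent_of_orderTop_pos (mem_polydisc.1 h i).2

/-- The value at a point of the polydisc of a power series with coefficients in `HahnInt`. -/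
def evalAt (lam : Fin n → HahnSeries ℝ 𝔽) (h : lam ∈ polydisc 𝔽 n) :
    MvPowerSeries (Fin n) (HahnInt 𝔽) →ₐ[HahnInt 𝔽] HahnInt 𝔽 :=
  aeval (hasEval_toInt h)

lemma seriesConvergesTo_evalAt {lam : Fin n → HahnSeries ℝ 𝔽} (h : lam ∈ polydisc 𝔽 n)
    (f : MvPowerSeries (Fin n) (HahnInt 𝔽)) :
    SeriesConvergesTo 𝔽 (fun m => (coeff m f : HahnInt 𝔽)) lam (evalAt lam h f : HahnInt 𝔽) := by
  intro r
  have hs := hasSum_aeval (hasEval_toInt h) f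
  obtain ⟨s, hs⟩ := mem_atTop_sets.1
    (hs ((hasBasis_nhds_orderIdeal (aeval (hasEval_toInt h) f)).mem_of_mem (i := r + 1) trivial))
  refine ⟨s, fun t ht => ?_⟩
  have h1 := mem_orderIdeal.1 (hs t ht)
  refine lt_of_lt_of_le (WithTop.coe_lt_coe.2 (lt_add_one r)) ?_
  have e : ∑ m ∈ t, ((coeff m f : HahnInt 𝔽) : HahnSeries ℝ 𝔽) * ∏ i, lam i ^ m i =
      (∑ m ∈ t, coeff m f • m.prod fun i k => toInt lam h i ^ k : HahnInt 𝔽) := by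
    rw [AddSubmonoidClass.coe_finsetSum]
    refine Finset.sum_congr rfl fun m _ => ?_
    rw [smul_eq_mul, Subring.coe_mul, Finsupp.prod_fintype _ _ (fun i => pow_zero _),
      SubmonoidClass.coe_finsetProd]
    rfl
  rw [← HahnSeries.orderTop_neg, neg_sub, e]
  exact h1

lemma SeriesConvergesTo.const_mul {c : (Fin n →₀ ℕ) → HahnSeries ℝ 𝔽}
    {lam : Fin n → HahnSeries ℝ 𝔽} {v : HahnSeries ℝ 𝔽}
    (h : SeriesConvergesTo 𝔽 c lam v) {a : HahnSeries ℝ 𝔽} (ha : 0 ≤ a.orderTop) :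
    SeriesConvergesTo 𝔽 (fun m => a * c m) lam (a * v) := by
  intro r
  obtain ⟨s, hs⟩ := h r
  refine ⟨s, fun t ht => (hs t ht).trans_le ?_⟩
  simp_rw [mul_assoc, ← Finset.mul_sum, ← mul_sub]
  rw [HahnSeries.orderTop_mul a]
  exact le_add_of_nonneg_left ha

lemma seriesConvergesTo_coordinate (j : Fin n) (lam : Fin n → HahnSeries ℝ 𝔽) :
    SeriesConvergesTo 𝔽 (Pi.single (Finsupp.single j 1) 1) lam (lam j) := by
  have := seriesConvergesTo_single (Finsupp.single j 1) (1 : HahnSeries ℝ 𝔽) lam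
  convert this using 1
  rw [one_mul, Finset.prod_eq_single j]
  · simp
  · intro i _ hij
    simp [Finsupp.single_eq_of_ne hij]
  · simp

/-- A quasi-identity morphism is the sum of the identity and of `q^ε` times a power series with
coefficients of nonnegative order. -/
lemma IsQuasiIdentity.exists_powerSeries
    {Υ : (Fin n → HahnSeries ℝ 𝔽) → (Fin n → HahnSeries ℝ 𝔽)} (hΥ : IsQuasiIdentity 𝔽 n Υ) :
    ∃ (ε : ℝ) (_ : 0 < ε) (F : Fin n → MvPowerSeries (Fin n) (HahnInt 𝔽)),
      ∀ lam (h : lam ∈ polydisc 𝔽 n) (j : Fin n),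
        Υ lam j = lam j + qpow 𝔽 ε * (evalAt lam h (F j) : HahnInt 𝔽) := by
  classical
  obtain ⟨hmaps, hseries, ε, hε, hest⟩ := hΥ
  have h0 : (0 : Fin n → HahnSeries ℝ 𝔽) ∈ polydisc 𝔽 n :=
    mem_polydisc.2 fun i => ⟨isNovikov_zero, by simp⟩
  obtain ⟨η, hη, hηΥ⟩ := exists_pos_le_orderTop fun i => (mem_polydisc.1 (hmaps h0) i).2
  choose c hc using hseries
  let d (j : Fin n) : (Fin n →₀ ℕ) → HahnSeries ℝ 𝔽 := c j - Pi.single (Finsupp.single j 1) 1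
  have hlin (lam) (h : lam ∈ polydisc 𝔽 n) (j) :
      SeriesConvergesTo 𝔽 (d j) lam (Υ lam j - lam j) := by
    exact (hc j lam h).sub (seriesConvergesTo_coordinate j lam)
  have hbound (j m) : ((min ε η : ℝ) : WithTop ℝ) ≤
      (d j m).orderTop := by
    have hcoef : (ε : WithTop ℝ) ≤ ((d j - Pi.single 0 (Υ 0 j) :
        (Fin n →₀ ℕ) → HahnSeries ℝ 𝔽) m).orderTop := by
      refine le_orderTop_coeff (val := fun lam => Υ lam j - lam j - Υ 0 j) (fun lam h => ?_)
        (fun lam h => ?_) m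
      · refine (hlin lam h j).sub ?_
        simpa using seriesConvergesTo_single 0 (Υ 0 j) lam
      · obtain ⟨δ, hδ, hδlam⟩ := exists_pos_le_orderTop fun i => (mem_polydisc.1 h i).2
        have := (memQdeltaGe_iff.1 (hest 0 lam h0 h δ hδ (fun i => memQdeltaGe_iff.2
          (by simpa using ⟨(mem_polydisc.1 h i).1, hδlam i⟩)) j)).2
        simp only [Pi.zero_apply, add_zero] at this
        exact (WithTop.coe_le_coe.2 (by linarith)).trans this
    have hsplit := sub_add_cancel (d j m)
      ((Pi.single 0 (Υ 0 j) : (Fin n →₀ ℕ) → HahnSeries ℝ 𝔽) m)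
    rw [← hsplit]
    refine le_orderTop_add ((WithTop.coe_le_coe.2 (min_le_left _ _)).trans hcoef) ?_
    refine (WithTop.coe_le_coe.2 (min_le_right _ _)).trans ?_
    by_cases hm : m = 0
    · subst hm
      simpa using hηΥ j
    · simp [Pi.single_eq_of_ne hm]
  choose F hF using fun j m => exists_eq_qpow_mul (hbound j m)
  refine ⟨min ε η, lt_min hε hη, fun j => F j, fun lam h j => ?_⟩
  rw [← sub_eq_iff_eq_add']
  refine (hlin lam h j).unique ?_
  have hconv := (seriesConvergesTo_evalAt h (F j)).const_mul (a := qpow 𝔽 (min ε η))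
    (by rw [orderTop_qpow]; exact_mod_cast (lt_min hε hη).le)
  convert hconv using 1
  exact funext fun m => hF j m

lemma evalAt_aeval {G : Fin n → MvPowerSeries (Fin n) (HahnInt 𝔽)} (hG : HasEval G)
    {lam mu : Fin n → HahnSeries ℝ 𝔽} (hlam : lam ∈ polydisc 𝔽 n) (hmu : mu ∈ polydisc 𝔽 n)
    (h : ∀ i, mu i = (evalAt lam hlam (G i) : HahnInt 𝔽))
    (f : MvPowerSeries (Fin n) (HahnInt 𝔽)) :
    evalAt lam hlam (aeval hG f) = evalAt mu hmu f := by
  have hcont : Continuous (evalAt lam hlam) := continuous_aeval (hasEval_toInt hlam)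
  have hcomp := DFunLike.congr_fun (comp_aeval hG hcont) f
  rw [AlgHom.comp_apply] at hcomp
  rw [hcomp]
  unfold evalAt
  rw [coe_aeval, coe_aeval]
  congr 1
  exact funext fun i => Subtype.ext (h i).symm

/-- Evaluations of a power series at points congruent modulo a closed ideal are congruent. -/
lemma aeval_sub_aeval_mem {R S σ : Type*} [CommRing R] [UniformSpace R] [IsUniformAddGroup R]
    [IsTopologicalSemiring R] [CommRing S] [UniformSpace S] [IsUniformAddGroup S]
    [CompleteSpace S] [T2Space S] [IsTopologicalRing S] [IsLinearTopology S S] [Algebra R S]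
    [ContinuousSMul R S] {J : Ideal S} (hJ : IsClosed (J : Set S)) {a b : σ → S}
    (ha : HasEval a) (hb : HasEval b) (hab : ∀ i, a i - b i ∈ J) (f : MvPowerSeries σ R) :
    aeval ha f - aeval hb f ∈ J := by
  refine hJ.mem_of_tendsto ((hasSum_aeval ha f).sub (hasSum_aeval hb f))
    (Eventually.of_forall fun s => J.sum_mem fun m _ => ?_)
  rw [← smul_sub, Algebra.smul_def]
  refine J.mul_mem_left _ ?_
  rw [← Ideal.Quotient.eq, Finsupp.prod, Finsupp.prod, map_prod, map_prod]
  refine Finset.prod_congr rfl fun i _ => ?_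
  rw [map_pow, map_pow, Ideal.Quotient.eq.2 (hab i)]

variable (𝔽 n) in
/-- The ideal of power series whose coefficients have order at least `r`. -/
def coeffIdeal (r : ℝ) : Ideal (MvPowerSeries (Fin n) (HahnInt 𝔽)) where
  carrier := {f | ∀ m, coeff m f ∈ orderIdeal 𝔽 r}
  add_mem' {a b} ha hb := by
    rw [Set.mem_ofPred_eq] at *
    exact fun m => by rw [map_add]; exact add_mem (ha m) (hb m)
  zero_mem' := by simp
  smul_mem' c x hx := by
    classical
    rw [Set.mem_ofPred_eq] at *
    intro m
    rw [smul_eq_mul, coeff_mul]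
    exact Ideal.sum_mem _ fun p _ => Ideal.mul_mem_left _ _ (hx p.2)

lemma mem_coeffIdeal {r : ℝ} {f : MvPowerSeries (Fin n) (HahnInt 𝔽)} :
    f ∈ coeffIdeal 𝔽 n r ↔ ∀ m, coeff m f ∈ orderIdeal 𝔽 r := Set.mem_ofPred

lemma coeffIdeal_anti {r s : ℝ} (h : r ≤ s) : coeffIdeal 𝔽 n s ≤ coeffIdeal 𝔽 n r :=
  fun _ hf => mem_coeffIdeal.2 fun m => orderIdeal_anti h (mem_coeffIdeal.1 hf m)

lemma isClosed_coeffIdeal (r : ℝ) :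
    IsClosed (coeffIdeal 𝔽 n r : Set (MvPowerSeries (Fin n) (HahnInt 𝔽))) := by
  have : (coeffIdeal 𝔽 n r : Set (MvPowerSeries (Fin n) (HahnInt 𝔽))) =
      ⋂ m, coeff m ⁻¹' (orderIdeal 𝔽 r : Set (HahnInt 𝔽)) := by
    ext f
    simp [mem_coeffIdeal]
  rw [this]
  exact isClosed_iInter fun m =>
    (isClosed_orderIdeal r).preimage (WithPiTopology.continuous_coeff _ m)

lemma qInt_smul_mem_coeffIdeal {ε r : ℝ} (hε : 0 ≤ ε) {f : MvPowerSeries (Fin n) (HahnInt 𝔽)}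
    (hf : f ∈ coeffIdeal 𝔽 n r) : qInt 𝔽 ε hε • f ∈ coeffIdeal 𝔽 n (r + ε) := by
  refine mem_coeffIdeal.2 fun m => mem_orderIdeal.2 ?_
  rw [coeff_smul, Subring.coe_mul, HahnSeries.orderTop_mul]
  change _ ≤ (qpow 𝔽 ε).orderTop + _
  rw [orderTop_qpow, add_comm r, WithTop.coe_add]
  exact add_le_add_right (mem_orderIdeal.1 (mem_coeffIdeal.1 hf m)) _

lemma mem_coeffIdeal_zero (f : MvPowerSeries (Fin n) (HahnInt 𝔽)) : f ∈ coeffIdeal 𝔽 n 0 :=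
  mem_coeffIdeal.2 fun _ => mem_orderIdeal.2 (orderTop_nonneg _)

lemma evalAt_mem_orderIdeal {lam : Fin n → HahnSeries ℝ 𝔽} (h : lam ∈ polydisc 𝔽 n) {r : ℝ}
    {f : MvPowerSeries (Fin n) (HahnInt 𝔽)} (hf : f ∈ coeffIdeal 𝔽 n r) :
    evalAt lam h f ∈ orderIdeal 𝔽 r := by
  refine (isClosed_orderIdeal r).mem_of_tendsto (hasSum_aeval (hasEval_toInt h) f)
    (Eventually.of_forall fun s => Ideal.sum_mem _ fun m _ => ?_)
  exact Ideal.mul_mem_right _ _ (mem_coeffIdeal.1 hf m)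

lemma hasEval_of_sub_X_mem {ε : ℝ} (hε : 0 < ε)
    {G : Fin n → MvPowerSeries (Fin n) (HahnInt 𝔽)} (hG : ∀ j, G j - X j ∈ coeffIdeal 𝔽 n ε) :
    HasEval G := by
  refine hasEval_of_finite fun j => LinearTopology.isTopologicallyNilpotent_of_constantCoeff
    (isTopologicallyNilpotent_of_orderTop_pos ?_)
  have := mem_orderIdeal.1 (mem_coeffIdeal.1 (hG j) 0)
  rw [coeff_zero_eq_constantCoeff_apply, map_sub, constantCoeff_X, sub_zero] at this
  exact lt_of_lt_of_le (by exact_mod_cast hε) this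

lemma evalAt_X {lam : Fin n → HahnSeries ℝ 𝔽} (h : lam ∈ polydisc 𝔽 n) (j : Fin n) :
    ((evalAt lam h (X j) : HahnInt 𝔽) : HahnSeries ℝ 𝔽) = lam j := by
  rw [evalAt, coe_aeval, eval₂_X]
  rfl

lemma evalAt_qInt_smul {lam : Fin n → HahnSeries ℝ 𝔽} (h : lam ∈ polydisc 𝔽 n) {ε : ℝ}
    (hε : 0 ≤ ε) (f : MvPowerSeries (Fin n) (HahnInt 𝔽)) :
    ((evalAt lam h (qInt 𝔽 ε hε • f) : HahnInt 𝔽) : HahnSeries ℝ 𝔽) =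
      qpow 𝔽 ε * (evalAt lam h f : HahnInt 𝔽) := by
  rw [map_smul]
  rfl

/-- A sequence of tuples of power series which is Cauchy uniformly in the coefficients converges
uniformly in the coefficients. -/
lemma exists_limit_coeffIdeal {ε : ℝ} (hε : 0 < ε)
    {H : ℕ → MvPowerSeries (Fin n) (HahnInt 𝔽)}
    (hH : ∀ k : ℕ, H (k + 1) - H k ∈ coeffIdeal 𝔽 n (k * ε)) :
    ∃ L, ∀ k : ℕ, L - H k ∈ coeffIdeal 𝔽 n (k * ε) := by
  have hlim (m) : ∃ l, Tendsto (fun k => coeff m (H k)) atTop (𝓝 l) := by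
    refine cauchySeq_tendsto_of_complete
      (NonarchimedeanAddGroup.cauchySeq_of_tendsto_sub_nhds_zero ?_)
    refine (hasBasis_nhds_orderIdeal 0).tendsto_right_iff.2 fun s _ => ?_
    obtain ⟨N, hN⟩ := exists_nat_ge (s / ε)
    filter_upwards [eventually_ge_atTop N] with k hk
    rw [← map_sub]
    rw [div_le_iff₀ hε] at hN
    have hk : (N : ℝ) ≤ k := by exact_mod_cast hk
    have := orderIdeal_anti (r := s) (by nlinarith) (mem_coeffIdeal.1 (hH k) m)
    simpa using this
  choose l hl using hlim
  obtain ⟨L, hL⟩ : ∃ L : MvPowerSeries (Fin n) (HahnInt 𝔽),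
      ∀ m, Tendsto (fun k => coeff m (H k)) atTop (𝓝 (coeff m L)) := ⟨l, hl⟩
  have hmono (k l : ℕ) : H (k + l) - H k ∈ coeffIdeal 𝔽 n (k * ε) := by
    induction l with
    | zero => simp
    | succ l ih =>
      have hl : (0 : ℝ) ≤ l := Nat.cast_nonneg l
      have := coeffIdeal_anti (r := k * ε) (by push_cast; nlinarith) (hH (k + l))
      simpa [add_assoc] using add_mem this ih
  refine ⟨L, fun k => mem_coeffIdeal.2 fun m => ?_⟩
  rw [map_sub]
  refine (isClosed_orderIdeal _).mem_of_tendsto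
    (((tendsto_add_atTop_iff_nat k).2 (hL m)).sub_const (coeff m (H k)))
    (Eventually.of_forall fun l => ?_)
  rw [← map_sub, add_comm]
  exact mem_coeffIdeal.1 (hmono k l) m

lemma eq_of_forall_sub_mem_coeffIdeal {ε : ℝ} (hε : 0 < ε)
    {f g : MvPowerSeries (Fin n) (HahnInt 𝔽)}
    (h : ∀ k : ℕ, f - g ∈ coeffIdeal 𝔽 n (k * ε)) : f = g := by
  ext m : 1
  refine Subtype.ext (eq_of_forall_le_orderTop_sub fun k => ?_)
  obtain ⟨N, hN⟩ := exists_nat_ge (k / ε)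
  rw [div_le_iff₀ hε] at hN
  have := orderIdeal_anti hN (mem_coeffIdeal.1 (h N) m)
  rw [map_sub] at this
  exact mem_orderIdeal.1 this

/-- One step of the fixed point iteration solving `H + q^ε F(H) = X`. -/
def inverseStep (ε : ℝ) (hε : 0 ≤ ε) (F H : Fin n → MvPowerSeries (Fin n) (HahnInt 𝔽))
    (j : Fin n) : MvPowerSeries (Fin n) (HahnInt 𝔽) :=
  X j - qInt 𝔽 ε hε • eval₂ (algebraMap (HahnInt 𝔽) _) H (F j)

/-- The iterates of `inverseStep` starting from the identity. -/
def inverseSeq (ε : ℝ) (hε : 0 ≤ ε) (F : Fin n → MvPowerSeries (Fin n) (HahnInt 𝔽)) (k : ℕ) :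
    Fin n → MvPowerSeries (Fin n) (HahnInt 𝔽) :=
  (inverseStep ε hε F)^[k] fun j => X j

section InverseSeries

variable {ε : ℝ} (hε : 0 < ε) (F : Fin n → MvPowerSeries (Fin n) (HahnInt 𝔽))

lemma inverseSeq_succ (k : ℕ) :
    inverseSeq ε hε.le F (k + 1) = inverseStep ε hε.le F (inverseSeq ε hε.le F k) :=
  Function.iterate_succ_apply' _ _ _

lemma inverseSeq_sub_X_mem (k : ℕ) (j : Fin n) :
    inverseSeq ε hε.le F k j - X j ∈ coeffIdeal 𝔽 n ε := by
  cases k with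
  | zero => simp [inverseSeq]
  | succ k =>
    rw [inverseSeq_succ hε, inverseStep, sub_sub_cancel_left]
    simpa using neg_mem (qInt_smul_mem_coeffIdeal hε.le (mem_coeffIdeal_zero _))

lemma hasEval_inverseSeq (k : ℕ) : HasEval (inverseSeq ε hε.le F k) :=
  hasEval_of_sub_X_mem hε (inverseSeq_sub_X_mem hε F k)

lemma inverseStep_sub_inverseStep_mem {r : ℝ} {H H' : Fin n → MvPowerSeries (Fin n) (HahnInt 𝔽)}
    (hH : HasEval H) (hH' : HasEval H') (h : ∀ j, H j - H' j ∈ coeffIdeal 𝔽 n r) (j : Fin n) :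
    inverseStep ε hε.le F H j - inverseStep ε hε.le F H' j ∈ coeffIdeal 𝔽 n (r + ε) := by
  rw [inverseStep, inverseStep, sub_sub_sub_cancel_left, ← smul_sub, ← coe_aeval hH,
    ← coe_aeval hH']
  refine qInt_smul_mem_coeffIdeal hε.le ?_
  rw [← neg_sub]
  exact neg_mem (aeval_sub_aeval_mem (isClosed_coeffIdeal r) hH hH' h (F j))

lemma inverseSeq_succ_sub_mem (k : ℕ) (j : Fin n) :
    inverseSeq ε hε.le F (k + 1) j - inverseSeq ε hε.le F k j ∈ coeffIdeal 𝔽 n (k * ε) := by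
  induction k generalizing j with
  | zero => simpa using mem_coeffIdeal_zero _
  | succ k ih =>
    rw [inverseSeq_succ hε F (k + 1)]
    nth_rewrite 2 [inverseSeq_succ hε F k]
    rw [Nat.cast_succ, add_one_mul]
    exact inverseStep_sub_inverseStep_mem hε F (hasEval_inverseSeq hε F (k + 1))
      (hasEval_inverseSeq hε F k) ih j

/-- The functional equation `H + q^ε F(H) = X` has a solution, approximated by `inverseSeq`. -/
lemma exists_inverseSeries : ∃ (L : Fin n → MvPowerSeries (Fin n) (HahnInt 𝔽)) (hL : HasEval L),
    (∀ (k : ℕ) j, L j - inverseSeq ε hε.le F k j ∈ coeffIdeal 𝔽 n (k * ε)) ∧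
    ∀ j, L j = X j - qInt 𝔽 ε hε.le • aeval hL (F j) := by
  choose L hL using fun j => exists_limit_coeffIdeal (H := fun k => inverseSeq ε hε.le F k j) hε
    fun k => inverseSeq_succ_sub_mem hε F k j
  have hLX (j) : L j - X j ∈ coeffIdeal 𝔽 n ε := by
    have h1 := hL j 1
    rw [Nat.cast_one, one_mul] at h1
    have h2 := add_mem h1 (inverseSeq_sub_X_mem hε F 1 j)
    rwa [sub_add_sub_cancel] at h2
  have hev := hasEval_of_sub_X_mem hε hLX
  refine ⟨L, hev, fun k j => hL j k, fun j => ?_⟩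
  rw [coe_aeval]
  refine eq_of_forall_sub_mem_coeffIdeal hε fun k => ?_
  have h1 := coeffIdeal_anti (r := k * ε) (by push_cast; nlinarith) (hL j (k + 1))
  have h2 := coeffIdeal_anti (r := k * ε) (by linarith) (inverseStep_sub_inverseStep_mem hε F hev
    (hasEval_inverseSeq hε F k) (fun i => hL i k) j)
  rw [inverseSeq_succ hε F k] at h1
  have h3 := sub_mem h1 h2
  rw [sub_sub_sub_cancel_right] at h3
  exact h3

end InverseSeries

end Evaluation

section Group

variable {n : ℕ} {Υ Υ₁ Υ₂ : (Fin n → HahnSeries ℝ 𝔽) → (Fin n → HahnSeries ℝ 𝔽)}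

lemma isQuasiIdentity_id : IsQuasiIdentity 𝔽 n id := by
  classical
  refine ⟨Set.mapsTo_id _, fun j => ⟨Pi.single (Finsupp.single j 1) 1, fun lam _ => ?_⟩,
    1, one_pos, fun lam lam' _ _ δ _ _ j => memQdeltaGe_iff.2 ?_⟩
  · exact seriesConvergesTo_coordinate j lam
  · have : id lam' j - lam' j - id lam j + lam j = 0 := by simp
    rw [this]
    exact ⟨isNovikov_zero, by simp⟩

/-- The power series of `λ ↦ λ + q^ε F(λ)` can be substituted into power series. -/
lemma hasEval_X_add_qInt_smul {ε : ℝ} (hε : 0 < ε)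
    (F : Fin n → MvPowerSeries (Fin n) (HahnInt 𝔽)) :
    HasEval fun j => X j + qInt 𝔽 ε hε.le • F j :=
  hasEval_of_sub_X_mem hε fun j => by
    simpa using qInt_smul_mem_coeffIdeal hε.le (mem_coeffIdeal_zero (F j))

lemma IsQuasiIdentity.comp (h₁ : IsQuasiIdentity 𝔽 n Υ₁) (h₂ : IsQuasiIdentity 𝔽 n Υ₂) :
    IsQuasiIdentity 𝔽 n (Υ₁ ∘ Υ₂) := by
  refine ⟨h₁.1.comp h₂.1, fun j => ?_, ?_⟩
  · obtain ⟨ε₁, hε₁, F₁, hF₁⟩ := h₁.exists_powerSeries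
    obtain ⟨ε₂, hε₂, F₂, hF₂⟩ := h₂.exists_powerSeries
    let G := aeval (hasEval_X_add_qInt_smul hε₂ F₂) (X j + qInt 𝔽 ε₁ hε₁.le • F₁ j)
    refine ⟨fun m => (coeff m G : HahnInt 𝔽), fun lam h => ?_⟩
    have hval : (Υ₁ ∘ Υ₂) lam j = (evalAt lam h G : HahnInt 𝔽) := by
      rw [evalAt_aeval _ h (h₂.1 h), map_add, Subring.coe_add, evalAt_X, evalAt_qInt_smul]
      · exact hF₁ _ _ j
      · intro i
        rw [map_add, Subring.coe_add, evalAt_X, evalAt_qInt_smul]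
        exact hF₂ lam h i
    rw [hval]
    exact seriesConvergesTo_evalAt h G
  · obtain ⟨hm₂, -, ε₂, hε₂, he₂⟩ := h₂
    obtain ⟨hm₁, -, ε₁, hε₁, he₁⟩ := h₁
    refine ⟨min ε₁ ε₂, lt_min hε₁ hε₂, fun lam lam' h h' δ hδ hd j => ?_⟩
    have hd₂ := he₂ lam lam' h h' δ hδ hd
    have hd₁ := he₁ _ _ (hm₂ h) (hm₂ h') δ hδ (fun i => ?_) j
    · have hd₂ := memQdeltaGe_iff.1 (hd₂ j)
      rw [memQdeltaGe_iff] at hd₁ ⊢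
      have e : (Υ₁ ∘ Υ₂) lam' j - lam' j - (Υ₁ ∘ Υ₂) lam j + lam j =
          (Υ₁ (Υ₂ lam') j - Υ₂ lam' j - Υ₁ (Υ₂ lam) j + Υ₂ lam j) +
          (Υ₂ lam' j - lam' j - Υ₂ lam j + lam j) := by
        simp only [Function.comp_apply]
        ring
      rw [e]
      refine ⟨hd₁.1.add hd₂.1, le_orderTop_add ?_ ?_⟩
      · exact (WithTop.coe_le_coe.2 (by gcongr; exact min_le_left _ _)).trans hd₁.2
      · exact (WithTop.coe_le_coe.2 (by gcongr; exact min_le_right _ _)).trans hd₂.2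
    · have hd₂ := memQdeltaGe_iff.1 (hd₂ i)
      have hd := memQdeltaGe_iff.1 (hd i)
      have e : Υ₂ lam' i - Υ₂ lam i =
          (Υ₂ lam' i - lam' i - Υ₂ lam i + lam i) + (lam' i - lam i) := by ring
      rw [memQdeltaGe_iff, e]
      exact ⟨hd₂.1.add hd.1,
        le_orderTop_add ((WithTop.coe_le_coe.2 (by linarith)).trans hd₂.2) hd.2⟩

/-- A map satisfying the quasi-identity estimate does not increase the order of differences. -/
lemma memQdeltaGe_sub_of_estimate {ε : ℝ} (hε : 0 < ε)
    (hest : ∀ lam lam', lam ∈ polydisc 𝔽 n → lam' ∈ polydisc 𝔽 n →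
      ∀ δ : ℝ, 0 < δ → (∀ i, MemQdeltaGe 𝔽 δ (lam' i - lam i)) →
      ∀ j, MemQdeltaGe 𝔽 (δ + ε) (Υ lam' j - lam' j - Υ lam j + lam j))
    {lam lam' : Fin n → HahnSeries ℝ 𝔽} (h : lam ∈ polydisc 𝔽 n) (h' : lam' ∈ polydisc 𝔽 n)
    {δ : ℝ} (hΥ : ∀ i, (δ : WithTop ℝ) ≤ (Υ lam' i - Υ lam i).orderTop) (i : Fin n) :
    MemQdeltaGe 𝔽 δ (lam' i - lam i) := by
  have hnov (i) : IsNovikov 𝔽 (lam' i - lam i) :=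
    (mem_polydisc.1 h' i).1.sub (mem_polydisc.1 h i).1
  obtain ⟨δ₀, hδ₀, hd₀⟩ := exists_pos_le_orderTop (f := fun i => lam' i - lam i) fun i =>
    lt_orderTop_sub (mem_polydisc.1 h' i).2 (mem_polydisc.1 h i).2
  have key (k : ℕ) (i) :
      ((min δ (δ₀ + k * ε) : ℝ) : WithTop ℝ) ≤ (lam' i - lam i).orderTop := by
    induction k generalizing i with
    | zero => exact (WithTop.coe_le_coe.2 (by simp)).trans (hd₀ i)
    | succ k ih =>
      have hk : (0 : ℝ) ≤ k * ε := by positivity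
      rcases le_or_gt δ (δ₀ + k * ε) with hle | hlt
      · rw [min_eq_left hle] at ih
        exact (WithTop.coe_le_coe.2 (min_le_left _ _)).trans (ih i)
      · rw [min_eq_right hlt.le] at ih
        have := memQdeltaGe_iff.1 (hest lam lam' h h' (δ₀ + k * ε) (by positivity)
          (fun i => memQdeltaGe_iff.2 ⟨hnov i, ih i⟩) i)
        have e : lam' i - lam i =
            (Υ lam' i - Υ lam i) - (Υ lam' i - lam' i - Υ lam i + lam i) := by ring
        rw [e]
        refine le_orderTop_sub ((WithTop.coe_le_coe.2 (min_le_left _ _)).trans (hΥ i))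
          ((WithTop.coe_le_coe.2 ((min_le_right _ _).trans ?_)).trans this.2)
        push_cast
        linarith
  obtain ⟨k, hk⟩ := exists_nat_ge (δ / ε)
  rw [div_le_iff₀ hε] at hk
  have := key k i
  rw [min_eq_left (by linarith)] at this
  exact memQdeltaGe_iff.2 ⟨hnov i, this⟩

lemma IsQuasiIdentity.injOn (hΥ : IsQuasiIdentity 𝔽 n Υ) : Set.InjOn Υ (polydisc 𝔽 n) := by
  obtain ⟨-, -, ε, hε, hest⟩ := hΥ
  refine fun lam h lam' h' heq => funext fun i => eq_of_forall_le_orderTop_sub fun δ => ?_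
  exact (memQdeltaGe_iff.1 (memQdeltaGe_sub_of_estimate hε hest h' h
    (fun i => by simp [heq]) i)).2

/-- The right inverse of a quasi-identity morphism is given by power series. -/
lemma IsQuasiIdentity.exists_rightInverse (hΥ : IsQuasiIdentity 𝔽 n Υ) :
    ∃ L : Fin n → MvPowerSeries (Fin n) (HahnInt 𝔽), ∀ mu (h : mu ∈ polydisc 𝔽 n),
      (fun j => ((evalAt mu h (L j) : HahnInt 𝔽) : HahnSeries ℝ 𝔽)) ∈ polydisc 𝔽 n ∧
      Υ (fun j => (evalAt mu h (L j) : HahnInt 𝔽)) = mu := by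
  obtain ⟨ε, hε, F, hF⟩ := hΥ.exists_powerSeries
  obtain ⟨L, hL, hLim, hLeq⟩ := exists_inverseSeries hε F
  refine ⟨L, fun mu h => ?_⟩
  have hseq (k : ℕ) : (fun j => ((evalAt mu h (inverseSeq ε hε.le F k j) : HahnInt 𝔽) :
      HahnSeries ℝ 𝔽)) ∈ polydisc 𝔽 n := by
    induction k with
    | zero => simpa only [inverseSeq, Function.iterate_zero, id_eq, evalAt_X] using h
    | succ k ih =>
      refine mem_polydisc.2 fun j => ?_
      have e : ((evalAt mu h (inverseSeq ε hε.le F (k + 1) j) : HahnInt 𝔽) : HahnSeries ℝ 𝔽) =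
          mu j - (Υ (fun j => (evalAt mu h (inverseSeq ε hε.le F k j) : HahnInt 𝔽)) j -
            (evalAt mu h (inverseSeq ε hε.le F k j) : HahnInt 𝔽)) := by
        rw [hF _ ih j, add_sub_cancel_left, inverseSeq_succ hε, inverseStep,
          ← coe_aeval (hasEval_inverseSeq hε F k), map_sub, AddSubgroupClass.coe_sub, evalAt_X,
          evalAt_qInt_smul, evalAt_aeval _ h ih fun _ => rfl]
      rw [e]
      have h1 := mem_polydisc.1 h j
      have h2 := mem_polydisc.1 (hΥ.1 ih) j
      have h3 := mem_polydisc.1 ih j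
      exact ⟨h1.1.sub (h2.1.sub h3.1), lt_orderTop_sub h1.2 (lt_orderTop_sub h2.2 h3.2)⟩
  have hmem : (fun j => ((evalAt mu h (L j) : HahnInt 𝔽) : HahnSeries ℝ 𝔽)) ∈ polydisc 𝔽 n := by
    have happrox (k : ℕ) (j) : ((k * ε : ℝ) : WithTop ℝ) ≤
        ((evalAt mu h (L j) : HahnInt 𝔽) - (evalAt mu h (inverseSeq ε hε.le F k j) : HahnInt 𝔽) :
          HahnSeries ℝ 𝔽).orderTop := by
      have := mem_orderIdeal.1 (evalAt_mem_orderIdeal h (hLim k j))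
      rwa [map_sub] at this
    refine mem_polydisc.2 fun j => ⟨IsNovikov.of_forall_approx fun c => ?_, ?_⟩
    · obtain ⟨k, hk⟩ := exists_nat_gt (c / ε)
      rw [div_lt_iff₀ hε] at hk
      exact ⟨_, (mem_polydisc.1 (hseq k) j).1,
        (WithTop.coe_lt_coe.2 hk).trans_le (happrox k j)⟩
    · have h1 := happrox 1 j
      rw [Nat.cast_one, one_mul] at h1
      have h2 := HahnSeries.min_orderTop_le_orderTop_add.trans_lt' (lt_min
        ((WithTop.coe_lt_coe.2 hε).trans_le h1) (mem_polydisc.1 (hseq 1) j).2)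
      rwa [sub_add_cancel] at h2
  refine ⟨hmem, funext fun j => ?_⟩
  rw [hF _ hmem j, ← evalAt_aeval hL h hmem (fun _ => rfl), ← evalAt_qInt_smul h hε.le,
    ← Subring.coe_add, ← map_add]
  conv_lhs => enter [1, 2, 1]; rw [hLeq j]
  rw [sub_add_cancel, evalAt_X]

lemma IsQuasiIdentity.exists_inverse (hΥ : IsQuasiIdentity 𝔽 n Υ) :
    ∃ Ψ, IsQuasiIdentity 𝔽 n Ψ ∧ Set.InvOn Ψ Υ (polydisc 𝔽 n) (polydisc 𝔽 n) := by
  classical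
  obtain ⟨L, hL⟩ := hΥ.exists_rightInverse
  let Ψ (mu : Fin n → HahnSeries ℝ 𝔽) (j : Fin n) : HahnSeries ℝ 𝔽 :=
    if h : mu ∈ polydisc 𝔽 n then (evalAt mu h (L j) : HahnInt 𝔽) else 0
  have hΨ {mu} (h : mu ∈ polydisc 𝔽 n) :
      Ψ mu = fun j => ((evalAt mu h (L j) : HahnInt 𝔽) : HahnSeries ℝ 𝔽) :=
    funext fun j => dif_pos h
  have hmaps : Set.MapsTo Ψ (polydisc 𝔽 n) (polydisc 𝔽 n) := fun mu h => by
    rw [hΨ h]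
    exact (hL mu h).1
  have hright : Set.RightInvOn Ψ Υ (polydisc 𝔽 n) := fun mu h => by
    rw [hΨ h]
    exact (hL mu h).2
  refine ⟨Ψ, ⟨hmaps, fun j => ⟨fun m => (coeff m (L j) : HahnInt 𝔽), fun mu h => ?_⟩, ?_⟩,
    hΥ.injOn.rightInvOn_of_leftInvOn hright hΥ.1 hmaps, hright⟩
  · rw [hΨ h]
    exact seriesConvergesTo_evalAt h (L j)
  · obtain ⟨-, -, ε, hε, hest⟩ := hΥ
    refine ⟨ε, hε, fun mu mu' h h' δ hδ hd j => ?_⟩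
    have := memQdeltaGe_iff.1 (hest _ _ (hmaps h) (hmaps h') δ hδ
      (memQdeltaGe_sub_of_estimate hε hest (hmaps h) (hmaps h') fun i => by
        rw [hright h, hright h']
        exact (memQdeltaGe_iff.1 (hd i)).2) j)
    rw [hright h, hright h'] at this
    have e : Ψ mu' j - mu' j - Ψ mu j + mu j = -(mu' j - Ψ mu' j - mu j + Ψ mu j) := by ring
    rw [memQdeltaGe_iff, e, HahnSeries.orderTop_neg]
    exact ⟨this.1.neg, this.2⟩

end Group

end QuasiIdentity

theorem quasiIdentity_bijective_inverse_and_group (n : ℕ) :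
    -- every quasi-identity morphism is a bijection of 𝒰 whose inverse is again one:
    (∀ Υ, IsQuasiIdentity 𝔽 n Υ →
      Set.BijOn Υ (polydisc 𝔽 n) (polydisc 𝔽 n) ∧
      ∃ Ψ, IsQuasiIdentity 𝔽 n Ψ ∧ Set.InvOn Ψ Υ (polydisc 𝔽 n) (polydisc 𝔽 n)) ∧
    -- consequently they form a group under composition:
    IsQuasiIdentity 𝔽 n id ∧
    (∀ Υ₁ Υ₂, IsQuasiIdentity 𝔽 n Υ₁ → IsQuasiIdentity 𝔽 n Υ₂ →
      IsQuasiIdentity 𝔽 n (Υ₁ ∘ Υ₂)) := by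
  refine ⟨fun Υ hΥ => ?_, isQuasiIdentity_id, fun Υ₁ Υ₂ => IsQuasiIdentity.comp⟩
  obtain ⟨Ψ, hΨ, hinv⟩ := hΥ.exists_inverse
  exact ⟨hinv.bijOn hΥ.1 hΨ.1, Ψ, hΨ, hinv⟩

end
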